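/- Let n ≥ 1 and Q = 2n+2. There exists c > 0 such that for every 0 < s < 1 and every Λ > 0 with s·Λ > Q−1, and for every pair (k,λ) with k ∈ ℕ, λ ≠ 0, |λ| ≤ 1 and ⟨λν⟩ ≤ Λ (where ν = 4k+2n), one has e^{(1/2)ν|λ|s} · ∫₀¹ |χ̂_{B_ρ}(λ,k)|² dρ ≥ c·s^{(Q−1)/2}. -/

import Mathlib

open MeasureTheory Complex

noncomputable section

/-- The generalized Laguerre polynomials
`L_k^δ(t) = t^{−δ} e^t (1/k!) (d/dt)^k (e^{−t} t^{k+δ})`. -/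
def genLaguerre (k : ℕ) (δ : ℝ) (t : ℝ) : ℝ :=
  t ^ (-δ) * Real.exp t * ((k.factorial : ℝ))⁻¹ *
    iteratedDeriv k (fun s => Real.exp (-s) * s ^ ((k : ℝ) + δ)) t

/-- The normalizing constant `r_k = (k!/(n+k−1)!)^{1/2}`. -/
def rk (n k : ℕ) : ℝ := Real.sqrt ((k.factorial : ℝ) / ((n + k - 1).factorial : ℝ))

/-- The Laguerre functions `Λ_k^{n−1}(t) = r_k L_k^{n−1}(t) e^{−t/2} t^{(n−1)/2}`. -/
def lagFun (n k : ℕ) (t : ℝ) : ℝ :=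
  rk n k * genLaguerre k ((n : ℝ) - 1) t * Real.exp (-t / 2) * t ^ (((n : ℝ) - 1) / 2)

/-- The radial Fourier coefficient
`f̂(λ,k) = r_k ∫₀^∞ f_#^λ(r) (|λ|r²)^{(1−n)/2} Λ_k^{n−1}(|λ|r²/2) r^{2n−1} dr`,
where `f_#^λ(r) = ∫_ℝ f_#(r,t) e^{iλt} dt`. -/
def radialCoeff (n : ℕ) (fsharp : ℝ → ℝ → ℂ) (lam : ℝ) (k : ℕ) : ℂ :=
  (rk n k : ℂ) * ∫ r in Set.Ioi (0 : ℝ),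
    (∫ t : ℝ, fsharp r t * Complex.exp (Complex.I * (lam : ℂ) * (t : ℂ))) *
      (((|lam| * r ^ 2) ^ ((1 - (n : ℝ)) / 2) : ℝ) : ℂ) *
      ((lagFun n k (|lam| * r ^ 2 / 2) : ℝ) : ℂ) *
      ((r ^ (2 * (n : ℝ) - 1) : ℝ) : ℂ)

/-- `ν = 4k + 2n`. -/
def nuv (n k : ℕ) : ℕ := 4 * k + 2 * n

/-- The radial Fourier coefficient of the indicator of `B = {(z,t) : |z| ≤ 1, |t| ≤ 1}`:
`χ̂_B(λ,k) = r_k (sin λ/λ^{n+1}) (2ν)^{(n+1)/2} ∫₀^{λ/(2ν)} Λ_k^{n−1}(νt) t^{(n−1)/2} dt`. -/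
def chiHatB (n k : ℕ) (lam : ℝ) : ℝ :=
  rk n k * (Real.sin lam / lam ^ (n + 1)) *
    (2 * (nuv n k : ℝ)) ^ (((n : ℝ) + 1) / 2) *
    ∫ t in (0 : ℝ)..(lam / (2 * (nuv n k : ℝ))),
      lagFun n k ((nuv n k : ℝ) * t) * t ^ (((n : ℝ) - 1) / 2)

/-- The Japanese bracket `⟨x⟩ = (1+x²)^{1/2}`. -/
def jap (x : ℝ) : ℝ := Real.sqrt (1 + x ^ 2)

/-- The Laguerre polynomial `L_k^m` with integer parameter `m`, normalized to be `1` at `0`. -/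
def normLaguerre (m k : ℕ) : Polynomial ℝ :=
  ∑ i ∈ Finset.range (k + 1),
    Polynomial.monomial i ((-1) ^ i * (m.factorial * k.choose i / (m + i).factorial : ℝ))

lemma normLaguerre_coeff (m k i : ℕ) :
    (normLaguerre m k).coeff i = (-1) ^ i * (m.factorial * k.choose i / (m + i).factorial : ℝ) := by
  simp only [normLaguerre, Polynomial.finsetSum_coeff, Polynomial.coeff_monomial,
    Finset.sum_ite_eq', Finset.mem_range]
  split_ifs with h
  · rfl
  · simp [Nat.choose_eq_zero_of_lt (show k < i by omega)]

lemma normLaguerre_eval (m k : ℕ) (t : ℝ) :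
    (normLaguerre m k).eval t = ∑ i ∈ Finset.range (k + 1),
      (-1) ^ i * (m.factorial * k.choose i / (m + i).factorial : ℝ) * t ^ i := by
  simp [normLaguerre, Polynomial.eval_finsetSum]

lemma normLaguerre_coeff_succ (m k i : ℕ) :
    ((i : ℝ) + 1) * (i + m + 1) * (normLaguerre m k).coeff (i + 1) =
      (i - k) * (normLaguerre m k).coeff i := by
  rw [normLaguerre_coeff, normLaguerre_coeff]
  have h1 : ((k.choose (i + 1) : ℕ) : ℝ) * (i + 1) = k.choose i * (k - i) := by
    rcases le_or_gt i k with h | h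
    · have := Nat.choose_succ_right_eq k i
      rw [← Nat.cast_sub h]
      exact_mod_cast this
    · simp [Nat.choose_eq_zero_of_lt h, Nat.choose_eq_zero_of_lt (show k < i + 1 by omega)]
  have h2 : ((m + (i + 1)).factorial : ℝ) = (i + m + 1) * (m + i).factorial := by
    rw [← add_assoc, Nat.factorial_succ]; push_cast; ring
  have h3 : ((m + i).factorial : ℝ) ≠ 0 := by positivity
  have h4 : ((i : ℝ) + m + 1) ≠ 0 := by positivity
  rw [h2, pow_succ]
  field_simp
  linear_combination -h1

lemma normLaguerre_ode (m k : ℕ) (t : ℝ) :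
    t * (normLaguerre m k).derivative.derivative.eval t
      + (m + 1 - t) * (normLaguerre m k).derivative.eval t
      + k * (normLaguerre m k).eval t = 0 := by
  have h : Polynomial.X * (normLaguerre m k).derivative.derivative
      + (Polynomial.C ((m : ℝ) + 1) - Polynomial.X) * (normLaguerre m k).derivative
      + Polynomial.C (k : ℝ) * (normLaguerre m k) = 0 := by
    ext i
    have := normLaguerre_coeff_succ m k i
    rcases i with _ | i
    · simp only [sub_mul, Polynomial.coeff_add, Polynomial.coeff_sub,
        Polynomial.coeff_derivative, Polynomial.mul_coeff_zero, Polynomial.coeff_X_zero,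
        Polynomial.coeff_zero, Polynomial.coeff_C_zero]
      push_cast at this ⊢
      linear_combination this
    · simp only [sub_mul, Polynomial.coeff_add, Polynomial.coeff_sub, Polynomial.coeff_C_mul,
        Polynomial.coeff_derivative, Polynomial.coeff_X_mul,
        Polynomial.coeff_zero]
      push_cast at this ⊢
      linear_combination this
  simpa using congrArg (Polynomial.eval t) h

lemma normLaguerre_eval_ge (m k : ℕ) {t : ℝ} (ht : 0 ≤ t) :
    2 - Real.exp (k * t) ≤ (normLaguerre m k).eval t := by
  have hs : |(normLaguerre m k).eval t - 1| ≤
      ∑ i ∈ Finset.range k, (k * t) ^ (i + 1) / (i + 1).factorial := by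
    rw [normLaguerre_eval, Finset.sum_range_succ']
    have h0 : (m.factorial : ℝ) ≠ 0 := by positivity
    simp only [pow_zero, Nat.choose_zero_right, Nat.cast_one, mul_one, add_zero, div_self h0,
      add_sub_cancel_right]
    refine (Finset.abs_sum_le_sum_abs _ _).trans (Finset.sum_le_sum fun i _ => ?_)
    have h1 : 0 ≤ (m.factorial * k.choose (i + 1) / (m + (i + 1)).factorial : ℝ) := by positivity
    rw [abs_mul, abs_mul, abs_pow, abs_neg, abs_one, one_pow, one_mul, abs_pow, abs_of_nonneg ht,
      abs_of_nonneg h1, mul_pow,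
      mul_div_right_comm ((k : ℝ) ^ (i + 1))]
    refine mul_le_mul_of_nonneg_right ?_ (by positivity)
    have h2 : ((k.choose (i + 1) : ℕ) : ℝ) ≤ k ^ (i + 1) / (i + 1).factorial :=
      Nat.choose_le_pow_div _ _
    calc (m.factorial : ℝ) * k.choose (i + 1) / (m + (i + 1)).factorial
        ≤ (m.factorial : ℝ) * k.choose (i + 1) / m.factorial := by
          gcongr
          exact Nat.le_add_right _ _
      _ = k.choose (i + 1) := by field_simp
      _ ≤ _ := h2
  have he := Real.sum_le_exp_of_nonneg (show 0 ≤ (k : ℝ) * t by positivity) (k + 1)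
  rw [Finset.sum_range_succ'] at he
  simp only [pow_zero, Nat.factorial_zero, Nat.cast_one, div_one] at he
  have := (abs_le.1 hs).1
  linarith

lemma genLaguerre_eq (m k : ℕ) {t : ℝ} (ht : 0 < t) :
    genLaguerre k m t =
      ((m + k).factorial / (k.factorial * m.factorial) : ℝ) * (normLaguerre m k).eval t := by
  have hf : (fun s : ℝ => Real.exp (-s) * s ^ ((k : ℝ) + m)) =
      fun s => Real.exp (-1 * s) * s ^ (m + k) := by
    ext s
    rw [← Nat.cast_add, Real.rpow_natCast, add_comm, neg_one_mul]
  rw [genLaguerre, hf, iteratedDeriv_fun_mul (by fun_prop) (by fun_prop), normLaguerre_eval,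
    Real.rpow_neg ht.le, Real.rpow_natCast, Finset.mul_sum, Finset.mul_sum]
  refine Finset.sum_congr rfl fun i hi => ?_
  have hik : i ≤ k := by simpa [Nat.lt_succ_iff] using hi
  rw [iteratedDeriv_pow, iteratedDeriv_exp_const_mul, show m + k - (k - i) = m + i by omega]
  have hd : (((m + k).descFactorial (k - i) : ℕ) : ℝ) = (m + k).factorial / (m + i).factorial := by
    rw [eq_div_iff (by positivity)]
    have := Nat.factorial_mul_descFactorial (show k - i ≤ m + k by omega)
    rw [show m + k - (k - i) = m + i by omega] at this
    rw [mul_comm]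
    exact_mod_cast this
  simp only [hd, neg_one_mul]
  have he : Real.exp t * Real.exp (-t) = 1 := by rw [← Real.exp_add]; simp
  have h1 : (m.factorial : ℝ) ≠ 0 := by positivity
  have h2 : ((m + i).factorial : ℝ) ≠ 0 := by positivity
  have h3 : (k.factorial : ℝ) ≠ 0 := by positivity
  field_simp
  rw [pow_add]
  linear_combination (k.choose i * t ^ m * t ^ i : ℝ) * he

/-- `ψ` solves the radial equation `ψ'' + (d/ρ) ψ' + (X - qρ²) ψ = 0`, written as a first order
system with `h = -ρ^d ψ'`, and `ψ` is not small where `X ρ² ≤ 1/4`. -/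
structure RadialSystem (d : ℕ) (X q : ℝ) (ψ h : ℝ → ℝ) : Prop where
  hasDerivAt_fst : ∀ ρ, 0 < ρ → HasDerivAt ψ (-(h ρ / ρ ^ d)) ρ
  hasDerivAt_snd : ∀ ρ, HasDerivAt h ((X - q * ρ ^ 2) * (ρ ^ d * ψ ρ)) ρ
  snd_zero : h 0 = 0
  half_le : ∀ ρ, 0 ≤ ρ → X * ρ ^ 2 ≤ 1 / 4 → 1 / 2 ≤ ψ ρ

/-- The energy `(X - qρ²) ρ^d ψ² + ρ^{-d} h²` of a radial system. -/
def radialEnergy (d : ℕ) (X q : ℝ) (ψ h : ℝ → ℝ) (ρ : ℝ) : ℝ :=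
  (X - q * ρ ^ 2) * (ρ ^ d * ψ ρ ^ 2) + h ρ ^ 2 / ρ ^ d

lemma hasDerivAt_pow_div (d : ℕ) {ρ : ℝ} (hρ : ρ ≠ 0) :
    HasDerivAt (fun r : ℝ => r ^ d) (d * ρ ^ d / ρ) ρ := by
  refine (hasDerivAt_pow d ρ).congr_deriv ?_
  rcases d with _ | d
  · simp
  · rw [pow_succ]; field_simp; simp

lemma hasDerivAt_coeff (X q ρ : ℝ) :
    HasDerivAt (fun r : ℝ => X - q * r ^ 2) (-(2 * q * ρ)) ρ := by
  refine (((hasDerivAt_pow 2 ρ).const_mul q).const_sub X).congr_deriv ?_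
  push_cast; ring

lemma monotoneOn_of_hasDerivAt {f f' : ℝ → ℝ} {a b : ℝ}
    (hf : ∀ x ∈ Set.Icc a b, HasDerivAt f (f' x) x) (h0 : ∀ x ∈ Set.Icc a b, 0 ≤ f' x) :
    MonotoneOn f (Set.Icc a b) := by
  refine monotoneOn_of_deriv_nonneg (convex_Icc a b)
    (fun x hx => (hf x hx).continuousAt.continuousWithinAt)
    (fun x hx => (hf x (interior_subset hx)).differentiableAt.differentiableWithinAt)
    fun x hx => ?_
  rw [(hf x (interior_subset hx)).deriv]
  exact h0 x (interior_subset hx)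

namespace RadialSystem

variable {d : ℕ} {X q : ℝ} {ψ h : ℝ → ℝ}

lemma hasDerivAt_mul (H : RadialSystem d X q ψ h) {ρ : ℝ} (hρ : 0 < ρ) :
    HasDerivAt (fun r => ψ r * h r)
      ((X - q * ρ ^ 2) * (ρ ^ d * ψ ρ ^ 2) - h ρ ^ 2 / ρ ^ d) ρ := by
  refine ((H.hasDerivAt_fst ρ hρ).mul (H.hasDerivAt_snd ρ)).congr_deriv ?_
  have : ρ ^ d ≠ 0 := by positivity
  field_simp
  ring

lemma hasDerivAt_energy (H : RadialSystem d X q ψ h) {ρ : ℝ} (hρ : 0 < ρ) :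
    HasDerivAt (radialEnergy d X q ψ h)
      (-(2 * q * ρ) * (ρ ^ d * ψ ρ ^ 2) +
        d / ρ * ((X - q * ρ ^ 2) * (ρ ^ d * ψ ρ ^ 2) - h ρ ^ 2 / ρ ^ d)) ρ := by
  have hP := hasDerivAt_pow_div d hρ.ne'
  have h1 : ρ ^ d ≠ 0 := by positivity
  refine (((hasDerivAt_coeff X q ρ).mul (hP.mul ((H.hasDerivAt_fst ρ hρ).pow 2))).add
    (((H.hasDerivAt_snd ρ).pow 2).div hP h1)).congr_deriv ?_
  simp only [Pi.mul_apply, Pi.pow_apply]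
  field_simp
  push_cast
  ring

lemma coeff_ge (hq : q ≤ 1 / 4) (hX : 2 ≤ X) {ρ : ℝ} (h0 : 0 < ρ) (h1 : ρ ≤ 1) :
    X / 2 ≤ X - q * ρ ^ 2 := by
  nlinarith [mul_nonneg h0.le h0.le, mul_le_one₀ h1 h0.le h1]

lemma energy_nonneg (hq : q ≤ 1 / 4) (hX : 2 ≤ X) {ρ : ℝ} (h0 : 0 < ρ) (h1 : ρ ≤ 1) :
    0 ≤ radialEnergy d X q ψ h ρ := by
  have := coeff_ge hq hX h0 h1
  have : 0 ≤ X - q * ρ ^ 2 := by linarith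
  unfold radialEnergy
  positivity

lemma abs_mul_le (hq : q ≤ 1 / 4) (hX : 2 ≤ X) {ρ : ℝ} (h0 : 0 < ρ) (h1 : ρ ≤ 1) :
    |ψ ρ * h ρ| ≤ radialEnergy d X q ψ h ρ / √X := by
  have hA := coeff_ge hq hX h0 h1
  have hX0 : 0 < X := by linarith
  rw [le_div_iff₀ (by positivity)]
  refine abs_le_of_sq_le_sq' ?_ (energy_nonneg hq hX h0 h1) |>.2
  rw [mul_pow, sq_abs, Real.sq_sqrt hX0.le, radialEnergy]
  have hP : 0 < ρ ^ d := by positivity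
  generalize X - q * ρ ^ 2 = A at *
  have : (A * (ρ ^ d * ψ ρ ^ 2) + h ρ ^ 2 / ρ ^ d) ^ 2 =
      (A * (ρ ^ d * ψ ρ ^ 2) - h ρ ^ 2 / ρ ^ d) ^ 2 + 4 * A * (ψ ρ * h ρ) ^ 2 := by
    field_simp; ring
  rw [this]
  nlinarith [sq_nonneg (A * (ρ ^ d * ψ ρ ^ 2) - h ρ ^ 2 / ρ ^ d), sq_nonneg (ψ ρ * h ρ)]

lemma monotoneOn_pow_mul_energy (H : RadialSystem d X q ψ h) (hd : 1 ≤ d) (hq : q ≤ 1 / 4)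
    (hX : 2 ≤ X) {a : ℝ} (ha : 0 < a) :
    MonotoneOn (fun ρ => ρ ^ d * radialEnergy d X q ψ h ρ) (Set.Icc a 1) := by
  have hd' : (1 : ℝ) ≤ d := by exact_mod_cast hd
  refine monotoneOn_of_hasDerivAt (f' := fun ρ =>
    (ρ ^ d * ψ ρ) ^ 2 / ρ * (2 * (d * (X - q * ρ ^ 2) - q * ρ ^ 2))) (fun ρ hρ => ?_) fun ρ hρ => ?_
  · have h0 : 0 < ρ := ha.trans_le hρ.1
    refine ((hasDerivAt_pow_div d h0.ne').mul (H.hasDerivAt_energy h0)).congr_deriv ?_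
    have h1 : ρ ^ d ≠ 0 := by positivity
    rw [radialEnergy]
    field_simp
    ring
  · have h0 : 0 < ρ := ha.trans_le hρ.1
    have hA := coeff_ge hq hX h0 hρ.2
    have : 0 ≤ d * (X - q * ρ ^ 2) - q * ρ ^ 2 := by
      have : q * ρ ^ 2 ≤ 1 / 4 := by nlinarith [mul_le_one₀ hρ.2 h0.le hρ.2, sq_nonneg ρ]
      nlinarith
    positivity

lemma antitoneOn_energy_div (H : RadialSystem d X q ψ h) (hd : 1 ≤ d) (hq : q ≤ 1 / 4)
    (hX : 2 ≤ X) {a : ℝ} (ha : 0 < a) :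
    AntitoneOn (fun ρ => radialEnergy d X q ψ h ρ / ((X - q * ρ ^ 2) * ρ ^ d)) (Set.Icc a 1) := by
  have hd' : (1 : ℝ) ≤ d := by exact_mod_cast hd
  rw [← neg_neg (fun ρ => radialEnergy d X q ψ h ρ / ((X - q * ρ ^ 2) * ρ ^ d))]
  refine MonotoneOn.neg ?_
  refine monotoneOn_of_hasDerivAt (f' := fun ρ =>
    (h ρ / (ρ ^ d * (X - q * ρ ^ 2))) ^ 2 / ρ * (2 * (d * (X - q * ρ ^ 2) - q * ρ ^ 2)))
    (fun ρ hρ => ?_) fun ρ hρ => ?_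
  · have h0 : 0 < ρ := ha.trans_le hρ.1
    have hA := coeff_ge hq hX h0 hρ.2
    have hA' : X - q * ρ ^ 2 ≠ 0 := by linarith
    have h1 : ρ ^ d ≠ 0 := by positivity
    refine ((H.hasDerivAt_energy h0).div
      ((hasDerivAt_coeff X q ρ).mul (hasDerivAt_pow_div d h0.ne'))
        (mul_ne_zero hA' h1)).neg.congr_deriv ?_
    simp only [Pi.mul_apply, radialEnergy]
    field_simp
    ring
  · have h0 : 0 < ρ := ha.trans_le hρ.1
    have hA := coeff_ge hq hX h0 hρ.2
    have : 0 ≤ d * (X - q * ρ ^ 2) - q * ρ ^ 2 := by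
      have : q * ρ ^ 2 ≤ 1 / 4 := by nlinarith [mul_le_one₀ hρ.2 h0.le hρ.2, sq_nonneg ρ]
      nlinarith
    positivity

lemma energy_one_ge (H : RadialSystem d X q ψ h) (hd : 1 ≤ d) (hq0 : 0 ≤ q) (hq : q ≤ 1 / 4)
    (hX : 2 ≤ X) (hXd : 2 * d ≤ √X) :
    X / (32 * Real.exp 2 * 4 ^ d * (2 * d) ^ d) ≤ √X ^ d * radialEnergy d X q ψ h 1 := by
  have hX0 : 0 < X := by linarith
  have hd' : (1 : ℝ) ≤ d := by exact_mod_cast hd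
  set κ := √X with hκ
  have hκ0 : 0 < κ := by positivity
  have hκ2 : κ ^ 2 = X := Real.sq_sqrt hX0.le
  set a : ℝ := 2 * d / κ with ha
  have ha0 : 0 < a := by positivity
  have ha1 : a ≤ 1 := by rw [ha, div_le_one hκ0]; exact hXd
  set E := radialEnergy d X q ψ h with hE
  have hcross : ∀ ρ ∈ Set.Icc a 1, |d / ρ * (ψ ρ * h ρ)| ≤ E ρ / 2 := by
    intro ρ hρ
    have h0 : 0 < ρ := ha0.trans_le hρ.1
    have hE0 : 0 ≤ E ρ := energy_nonneg hq hX h0 hρ.2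
    have h2 : 2 * d ≤ ρ * κ := by rw [← div_le_iff₀ hκ0]; exact hρ.1
    rw [abs_mul, abs_of_pos (show 0 < d / ρ by positivity)]
    calc d / ρ * |ψ ρ * h ρ| ≤ d / ρ * (E ρ / κ) :=
          mul_le_mul_of_nonneg_left (abs_mul_le hq hX h0 hρ.2) (by positivity)
      _ = 2 * d / (ρ * κ) * (E ρ / 2) := by field_simp
      _ ≤ 1 * (E ρ / 2) :=
          mul_le_mul_of_nonneg_right (by rw [div_le_one (by positivity)]; exact h2) (by positivity)
      _ = _ := one_mul _
  have hmono : MonotoneOn (fun ρ => (E ρ - d / ρ * (ψ ρ * h ρ)) *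
      Real.exp (2 * ρ / X - 2 * d / (κ * ρ))) (Set.Icc a 1) := by
    refine monotoneOn_of_hasDerivAt (f' := fun ρ =>
      (-(2 * q * ρ) * (ρ ^ d * ψ ρ ^ 2) + d / ρ ^ 2 * (ψ ρ * h ρ) +
        (E ρ - d / ρ * (ψ ρ * h ρ)) * (2 / X + 2 * d / (κ * ρ ^ 2))) *
        Real.exp (2 * ρ / X - 2 * d / (κ * ρ))) (fun ρ hρ => ?_) fun ρ hρ => ?_
    · have h0 : 0 < ρ := ha0.trans_le hρ.1
      have e1 : HasDerivAt (fun ρ : ℝ => 2 * ρ / X - 2 * d / (κ * ρ))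
          (2 / X + 2 * d / (κ * ρ ^ 2)) ρ := by
        refine ((((hasDerivAt_id ρ).const_mul 2).div_const X).sub
          ((hasDerivAt_const ρ (2 * (d : ℝ))).div ((hasDerivAt_id ρ).const_mul κ)
            (by simp; exact ⟨hκ0.ne', h0.ne'⟩))).congr_deriv ?_
        simp only [id]
        field_simp
        ring
      have e2 : HasDerivAt (fun ρ : ℝ => d / ρ) (-d / ρ ^ 2) ρ := by
        refine ((hasDerivAt_const ρ (d : ℝ)).div (hasDerivAt_id ρ) h0.ne').congr_deriv ?_
        simp
      refine (((H.hasDerivAt_energy h0).sub (e2.mul (H.hasDerivAt_mul h0))).mul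
        e1.exp).congr_deriv ?_
      simp only [Pi.sub_apply, Pi.mul_apply]
      ring
    · have h0 : 0 < ρ := ha0.trans_le hρ.1
      have hA := coeff_ge hq hX h0 hρ.2
      have hE0 : 0 ≤ E ρ := energy_nonneg hq hX h0 hρ.2
      refine mul_nonneg ?_ (Real.exp_pos _).le
      have c1 := (abs_le.1 (hcross ρ hρ)).2
      have c2 := (abs_le.1 (abs_mul_le (ψ := ψ) (h := h) (d := d) hq hX h0 hρ.2)).1
      have c3 : 2 * q * ρ * (ρ ^ d * ψ ρ ^ 2) ≤ E ρ / X := by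
        rw [le_div_iff₀ hX0]
        have hp : 0 ≤ ρ ^ d * ψ ρ ^ 2 := by positivity
        have hh : 0 ≤ h ρ ^ 2 / ρ ^ d := by positivity
        have h1 : 2 * q * ρ ≤ 1 / 2 := by nlinarith [hρ.2]
        calc 2 * q * ρ * (ρ ^ d * ψ ρ ^ 2) * X ≤ 1 / 2 * (ρ ^ d * ψ ρ ^ 2) * X := by gcongr
          _ = X / 2 * (ρ ^ d * ψ ρ ^ 2) := by ring
          _ ≤ (X - q * ρ ^ 2) * (ρ ^ d * ψ ρ ^ 2) := by gcongr
          _ ≤ E ρ := by simp only [hE, radialEnergy]; linarith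
      have c4 : -(d / ρ ^ 2 * (E ρ / κ)) ≤ d / ρ ^ 2 * (ψ ρ * h ρ) := by
        rw [← mul_neg]
        exact mul_le_mul_of_nonneg_left c2 (by positivity)
      have c5 : E ρ / 2 * (2 / X + 2 * d / (κ * ρ ^ 2)) ≤
          (E ρ - d / ρ * (ψ ρ * h ρ)) * (2 / X + 2 * d / (κ * ρ ^ 2)) :=
        mul_le_mul_of_nonneg_right (by linarith) (by positivity)
      have c6 : E ρ / 2 * (2 / X + 2 * d / (κ * ρ ^ 2)) =
        E ρ / X + d / ρ ^ 2 * (E ρ / κ) := by field_simp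
      linarith
  have hE1 : 0 ≤ E 1 := energy_nonneg hq hX one_pos le_rfl
  have hEa : 0 ≤ E a := energy_nonneg hq hX ha0 ha1
  have hgron : E a ≤ 4 * Real.exp 2 * E 1 := by
    have m := hmono (Set.left_mem_Icc.2 ha1) (Set.right_mem_Icc.2 ha1) ha1
    simp only at m
    have c1 := (abs_le.1 (hcross a (Set.left_mem_Icc.2 ha1))).2
    have c2 := (abs_le.1 (hcross 1 (Set.right_mem_Icc.2 ha1))).1
    have l : E a / 2 * Real.exp (-1) ≤
        (E a - d / a * (ψ a * h a)) * Real.exp (2 * a / X - 2 * d / (κ * a)) := by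
      have : 2 * d / (κ * a) = 1 := by rw [ha]; field_simp
      rw [this]
      have : 0 ≤ 2 * a / X := by positivity
      gcongr <;> linarith
    have r : (E 1 - d / 1 * (ψ 1 * h 1)) * Real.exp (2 * 1 / X - 2 * d / (κ * 1)) ≤
        2 * E 1 * Real.exp 1 := by
      have h3 : 2 * 1 / X ≤ 1 := by rw [div_le_one hX0]; linarith
      have h4 : 0 ≤ 2 * d / (κ * 1) := by positivity
      gcongr <;> linarith
    have lr := (l.trans m).trans r
    calc E a = 2 * Real.exp 1 * (E a / 2 * Real.exp (-1)) := by
          rw [Real.exp_neg]; field_simp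
      _ ≤ 2 * Real.exp 1 * (2 * E 1 * Real.exp 1) := by gcongr
      _ = _ := by
          rw [show (2 : ℝ) = 1 + 1 by norm_num, Real.exp_add]; ring
  set b : ℝ := 1 / (2 * κ) with hb
  have hb0 : 0 < b := by positivity
  have hba : b ≤ a := by
    rw [hb, ha, div_le_div_iff₀ (by positivity) hκ0]
    nlinarith
  have hS := H.monotoneOn_pow_mul_energy hd hq hX hb0 (Set.left_mem_Icc.2 (hba.trans ha1))
    ⟨hba, ha1⟩ hba
  simp only at hS
  have hEb : X / 8 * (b ^ d) ^ 2 ≤ b ^ d * E b := by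
    have hA := coeff_ge hq hX hb0 (hba.trans ha1)
    have hψ := H.half_le b hb0.le (by rw [hb, ← hκ2]; field_simp; norm_num)
    have hψ2 : 1 / 4 ≤ ψ b ^ 2 := by nlinarith
    have : 0 ≤ h b ^ 2 / b ^ d := by positivity
    have hA0 : 0 ≤ X - q * b ^ 2 := by linarith
    calc X / 8 * (b ^ d) ^ 2 = b ^ d * (X / 2 * (b ^ d * (1 / 4))) := by ring
      _ ≤ b ^ d * ((X - q * b ^ 2) * (b ^ d * ψ b ^ 2)) := by gcongr
      _ ≤ b ^ d * E b := by
        refine mul_le_mul_of_nonneg_left ?_ (by positivity)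
        simp only [hE, radialEnergy]; linarith
  have hfin : X / 8 * (b ^ d) ^ 2 ≤ a ^ d * (4 * Real.exp 2 * E 1) :=
    (hEb.trans hS).trans (by gcongr)
  rw [div_le_iff₀ (by positivity)]
  have hab : κ ^ d * a ^ d = (2 * d) ^ d := by
    rw [← mul_pow, ha]; congr 1; field_simp
  have hbb : 4 ^ d * (κ ^ d * b ^ d) ^ 2 = 1 := by
    rw [← mul_pow, ← pow_mul, mul_comm d 2, pow_mul, ← mul_pow, hb,
      show 4 * (κ * (1 / (2 * κ))) ^ 2 = 1 by field_simp; norm_num, one_pow]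
  calc X = 8 * (4 ^ d * (κ ^ d) ^ 2) * (X / 8 * (b ^ d) ^ 2) := by
        linear_combination (-X) * hbb
    _ ≤ 8 * (4 ^ d * (κ ^ d) ^ 2) * (a ^ d * (4 * Real.exp 2 * E 1)) := by gcongr
    _ = κ ^ d * E 1 * (32 * Real.exp 2 * 4 ^ d * (2 * d) ^ d) := by
        linear_combination (32 * 4 ^ d * κ ^ d * Real.exp 2 * E 1) * hab

lemma energy_le (H : RadialSystem d X q ψ h) (hd : 1 ≤ d) (hq : q ≤ 1 / 4) (hX : 2 ≤ X) {ρ : ℝ}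
    (h0 : 0 < ρ) (h1 : ρ ≤ 1) :
    ρ ^ d * radialEnergy d X q ψ h ρ ≤ radialEnergy d X q ψ h 1 := by
  simpa using H.monotoneOn_pow_mul_energy hd hq hX h0 (Set.left_mem_Icc.2 h1)
    (Set.right_mem_Icc.2 h1) h1

lemma sq_snd_le (H : RadialSystem d X q ψ h) (hd : 1 ≤ d) (hq : q ≤ 1 / 4) (hX : 2 ≤ X) {ρ : ℝ}
    (h0 : 0 < ρ) (h1 : ρ ≤ 1) : h ρ ^ 2 ≤ radialEnergy d X q ψ h 1 := by
  refine le_trans ?_ (H.energy_le hd hq hX h0 h1)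
  have hA := coeff_ge hq hX h0 h1
  have : 0 ≤ X - q * ρ ^ 2 := by linarith
  have hP : ρ ^ d ≠ 0 := by positivity
  have : 0 ≤ (X - q * ρ ^ 2) * (ρ ^ d * ψ ρ) ^ 2 := by positivity
  calc h ρ ^ 2 ≤ (X - q * ρ ^ 2) * (ρ ^ d * ψ ρ) ^ 2 + h ρ ^ 2 := by linarith
    _ = _ := by rw [radialEnergy]; field_simp

lemma pow_mul_energy_one_le (H : RadialSystem d X q ψ h) (hd : 1 ≤ d) (hq0 : 0 ≤ q)
    (hq : q ≤ 1 / 4) (hX : 2 ≤ X) {ρ : ℝ} (h0 : 0 < ρ) (h1 : ρ ≤ 1) :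
    ρ ^ d * radialEnergy d X q ψ h 1 ≤ radialEnergy d X q ψ h ρ := by
  have m := H.antitoneOn_energy_div hd hq hX h0 (Set.left_mem_Icc.2 h1)
    (Set.right_mem_Icc.2 h1) h1
  have hA := coeff_ge hq hX h0 h1
  have hA1 := coeff_ge hq hX one_pos le_rfl
  have hE1 : 0 ≤ radialEnergy d X q ψ h 1 := energy_nonneg hq hX one_pos le_rfl
  simp only [one_pow, mul_one] at m hA1
  have hA0 : 0 < X - q * ρ ^ 2 := by linarith
  rw [div_le_div_iff₀ (by linarith) (by positivity)] at m
  have hAA : X - q ≤ X - q * ρ ^ 2 := by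
    nlinarith [mul_le_one₀ h1 h0.le h1]
  have : (X - q) * (ρ ^ d * radialEnergy d X q ψ h 1) ≤
      (X - q) * radialEnergy d X q ψ h ρ := by
    calc (X - q) * (ρ ^ d * radialEnergy d X q ψ h 1)
        ≤ (X - q * ρ ^ 2) * (ρ ^ d * radialEnergy d X q ψ h 1) := by gcongr
      _ ≤ _ := by linarith
  exact le_of_mul_le_mul_left this (by linarith)

lemma integral_sq_snd_ge (H : RadialSystem d X q ψ h) (hd : 1 ≤ d) (hq0 : 0 ≤ q)
    (hq : q ≤ 1 / 4) (hX : 2 ≤ X) (hXd : 8 * 4 ^ d ≤ √X) :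
    radialEnergy d X q ψ h 1 / (8 * 4 ^ d) ≤ ∫ ρ in (1 / 2 : ℝ)..1, h ρ ^ 2 := by
  set E := radialEnergy d X q ψ h with hE
  have hE1 : 0 ≤ E 1 := energy_nonneg hq hX one_pos le_rfl
  have hκ0 : 0 < √X := lt_of_lt_of_le (by positivity) hXd
  have hch : Continuous h := continuous_iff_continuousAt.2 fun ρ => (H.hasDerivAt_snd ρ).continuousAt
  have hu : Set.uIcc (1 / 2 : ℝ) 1 = Set.Icc (1 / 2) 1 := Set.uIcc_of_le (by norm_num)
  have hpos : ∀ ρ ∈ Set.uIcc (1 / 2 : ℝ) 1, 0 < ρ := fun ρ hρ => by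
    rw [hu] at hρ; linarith [hρ.1]
  have hcψ : ContinuousOn ψ (Set.uIcc (1 / 2 : ℝ) 1) := fun ρ hρ =>
    (H.hasDerivAt_fst ρ (hpos ρ hρ)).continuousAt.continuousWithinAt
  have hcq : ContinuousOn (fun ρ => h ρ ^ 2 / ρ ^ d) (Set.uIcc (1 / 2 : ℝ) 1) :=
    (hch.pow 2).continuousOn.div (continuous_pow d).continuousOn
      fun ρ hρ => pow_ne_zero _ (hpos ρ hρ).ne'
  have hcp : ContinuousOn (fun ρ => (X - q * ρ ^ 2) * (ρ ^ d * ψ ρ ^ 2))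
      (Set.uIcc (1 / 2 : ℝ) 1) := by fun_prop
  have hFTC : ∫ ρ in (1 / 2 : ℝ)..1, ((X - q * ρ ^ 2) * (ρ ^ d * ψ ρ ^ 2) - h ρ ^ 2 / ρ ^ d) =
      ψ 1 * h 1 - ψ (1 / 2) * h (1 / 2) :=
    intervalIntegral.integral_eq_sub_of_hasDerivAt (fun ρ hρ => H.hasDerivAt_mul (hpos ρ hρ))
      (hcp.sub hcq).intervalIntegrable
  have hcE : ContinuousOn E (Set.uIcc (1 / 2 : ℝ) 1) := hcp.add hcq
  have hsplit : ∫ ρ in (1 / 2 : ℝ)..1, E ρ =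
      (∫ ρ in (1 / 2 : ℝ)..1, ((X - q * ρ ^ 2) * (ρ ^ d * ψ ρ ^ 2) - h ρ ^ 2 / ρ ^ d)) +
        ∫ ρ in (1 / 2 : ℝ)..1, 2 * (h ρ ^ 2 / ρ ^ d) := by
    refine Eq.trans ?_ (intervalIntegral.integral_add (hcp.sub hcq).intervalIntegrable
      (hcq.const_mul 2).intervalIntegrable)
    congr 1
    ext ρ
    simp only [hE, radialEnergy]; ring
  have hlow : 1 / 2 * ((1 / 2) ^ d * E 1) ≤ ∫ ρ in (1 / 2 : ℝ)..1, E ρ := by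
    calc 1 / 2 * ((1 / 2) ^ d * E 1) = ∫ ρ in (1 / 2 : ℝ)..1, (1 / 2) ^ d * E 1 := by
          rw [intervalIntegral.integral_const, smul_eq_mul]; norm_num
      _ ≤ _ := by
        refine intervalIntegral.integral_mono_on (by norm_num) (by simp) hcE.intervalIntegrable ?_
        intro ρ hρ
        have h0 : 0 < ρ := by linarith [hρ.1]
        refine le_trans ?_ (H.pow_mul_energy_one_le hd hq0 hq hX h0 hρ.2)
        exact mul_le_mul_of_nonneg_right (pow_le_pow_left₀ (by norm_num) hρ.1 d) hE1
  have hup : ∫ ρ in (1 / 2 : ℝ)..1, 2 * (h ρ ^ 2 / ρ ^ d) ≤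
      2 * 2 ^ d * ∫ ρ in (1 / 2 : ℝ)..1, h ρ ^ 2 := by
    rw [← intervalIntegral.integral_const_mul]
    refine intervalIntegral.integral_mono_on (by norm_num) (hcq.const_mul 2).intervalIntegrable
      ((hch.pow 2).const_mul _).continuousOn.intervalIntegrable fun ρ hρ => ?_
    have h0 : 0 < ρ := by linarith [hρ.1]
    have : 1 ≤ 2 ^ d * ρ ^ d := by
      rw [← mul_pow]; exact one_le_pow₀ (by linarith [hρ.1])
    rw [mul_assoc]
    refine mul_le_mul_of_nonneg_left ?_ (by norm_num)
    rw [div_le_iff₀ (by positivity)]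
    nlinarith [sq_nonneg (h ρ)]
  have hb1 : |ψ 1 * h 1| ≤ E 1 / √X := abs_mul_le hq hX one_pos le_rfl
  have hb2 : |ψ (1 / 2) * h (1 / 2)| ≤ 2 ^ d * E 1 / √X := by
    refine (abs_mul_le (d := d) hq hX (by norm_num) (by norm_num)).trans ?_
    have := H.energy_le hd hq hX (ρ := 1 / 2) (by norm_num) (by norm_num)
    rw [one_div, inv_pow, inv_mul_le_iff₀ (by positivity)] at this
    rw [one_div]
    gcongr
  have h2d : (1 : ℝ) ≤ 2 ^ d := one_le_pow₀ (by norm_num)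
  have hb3 : E 1 / √X + 2 ^ d * E 1 / √X ≤ 1 / 4 * ((1 / 2) ^ d * E 1) := by
    have h4 : (4 : ℝ) ^ d = 2 ^ d * 2 ^ d := by rw [← mul_pow]; norm_num
    rw [← add_div, div_le_iff₀ hκ0]
    calc E 1 + 2 ^ d * E 1 ≤ 2 ^ d * E 1 + 2 ^ d * E 1 := by nlinarith
      _ = 1 / 4 * ((1 / 2) ^ d * E 1) * (8 * 4 ^ d) := by
        rw [h4, one_div, one_div, inv_pow]; field_simp; ring
      _ ≤ _ := by gcongr
  have h4 : (4 : ℝ) ^ d = 2 ^ d * 2 ^ d := by rw [← mul_pow]; norm_num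
  have l1 := (abs_le.1 hb1).2
  have l2 := (abs_le.1 hb2).1
  have key : 1 / 4 * ((1 / 2) ^ d * E 1) ≤ 2 * 2 ^ d * ∫ ρ in (1 / 2 : ℝ)..1, h ρ ^ 2 := by
    linarith
  rw [div_le_iff₀ (by positivity), h4]
  rw [one_div_pow] at key
  have := mul_le_mul_of_nonneg_left key (show (0 : ℝ) ≤ 4 * 2 ^ d by positivity)
  calc E 1 = 4 * 2 ^ d * (1 / 4 * (1 / 2 ^ d * E 1)) := by field_simp
    _ ≤ _ := this
    _ = _ := by ring

lemma abs_snd_div_sub_le (H : RadialSystem d X q ψ h) (hd : 1 ≤ d) (hq0 : 0 ≤ q)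
    (hq : q ≤ 1 / 4) (hX : 2 ≤ X) {J : ℝ → ℝ} (hJ : ∀ ρ, HasDerivAt J (ρ ^ d * ψ ρ) ρ)
    (hJ0 : J 0 = 0) {ρ : ℝ} (h0 : 0 < ρ) (h1 : ρ ≤ 1) :
    |h ρ / (X - q * ρ ^ 2) - J ρ| ≤ 2 * √(radialEnergy d X q ψ h 1) / X ^ 2 := by
  have hX0 : 0 < X := by linarith
  have hA : ∀ r ∈ Set.Icc (0 : ℝ) 1, X / 2 ≤ X - q * r ^ 2 := by
    intro r hr
    rcases hr.1.eq_or_lt with rfl | h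
    · simp; linarith
    · exact coeff_ge hq hX h hr.2
  have key := (convex_Icc (0 : ℝ) 1).norm_image_sub_le_of_norm_hasDerivWithin_le
    (f := fun r => h r / (X - q * r ^ 2) - J r)
    (f' := fun r => h r * (2 * q * r) / (X - q * r ^ 2) ^ 2)
    (C := 2 * √(radialEnergy d X q ψ h 1) / X ^ 2) (x := 0) (y := ρ)
    (fun r hr => ?_) (fun r hr => ?_) ⟨le_rfl, zero_le_one⟩ ⟨h0.le, h1⟩
  · simp only [H.snd_zero, hJ0, zero_div, sub_zero, Real.norm_eq_abs, abs_of_pos h0] at key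
    refine key.trans ?_
    exact mul_le_of_le_one_right (by positivity) h1
  · have hA' : X - q * r ^ 2 ≠ 0 := by linarith [hA r hr]
    refine (((H.hasDerivAt_snd r).div (hasDerivAt_coeff X q r) hA').sub
      (hJ r)).hasDerivWithinAt.congr_deriv ?_
    field_simp
    ring
  · have hh : |h r| ≤ √(radialEnergy d X q ψ h 1) := by
      rcases hr.1.eq_or_lt with rfl | h
      · simp [H.snd_zero]
      · exact Real.abs_le_sqrt (H.sq_snd_le hd hq hX h hr.2)
    have hqr : 0 ≤ 2 * q * r := mul_nonneg (by linarith) hr.1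
    rw [Real.norm_eq_abs, abs_div, abs_mul, abs_of_nonneg hqr,
      abs_of_nonneg (sq_nonneg (X - q * r ^ 2))]
    have hs := Real.sqrt_nonneg (radialEnergy d X q ψ h 1)
    calc |h r| * (2 * q * r) / (X - q * r ^ 2) ^ 2
        ≤ √(radialEnergy d X q ψ h 1) * (1 / 2) / (X / 2) ^ 2 := by
          gcongr
          · nlinarith [hr.1, hr.2]
          · exact hA r hr
      _ = _ := by field_simp

/-- Mean square lower bound for the primitive of an oscillating solution. -/
theorem integral_sq_primitive_ge (H : RadialSystem d X q ψ h) (hd : 1 ≤ d) (hq0 : 0 ≤ q)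
    (hq : q ≤ 1 / 4) (hXd : 8 * 4 ^ d ≤ √X) {J : ℝ → ℝ}
    (hJ : ∀ ρ, HasDerivAt J (ρ ^ d * ψ ρ) ρ) (hJ0 : J 0 = 0) :
    1 / (1024 * Real.exp 2 * 16 ^ d * (2 * d) ^ d) ≤
      √X ^ (d + 2) * ∫ ρ in (1 / 2 : ℝ)..1, J ρ ^ 2 := by
  have h4d : (1 : ℝ) ≤ 4 ^ d := one_le_pow₀ (by norm_num)
  have hκ0 : 0 < √X := lt_of_lt_of_le (by positivity) hXd
  have hX0 : 0 < X := Real.sqrt_pos.1 hκ0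
  have hκ2 : √X ^ 2 = X := Real.sq_sqrt hX0.le
  have hX64 : 64 * 4 ^ d ≤ X := by nlinarith
  have hX : 2 ≤ X := by linarith
  have hd4 : (2 * d : ℝ) ≤ 8 * 4 ^ d := by
    have : (d : ℝ) < 4 ^ d := by exact_mod_cast d.lt_pow_self (by norm_num)
    linarith
  have b1 := H.energy_one_ge hd hq0 hq hX (hd4.trans hXd)
  have b2 := H.integral_sq_snd_ge hd hq0 hq hX hXd
  set E := radialEnergy d X q ψ h with hE
  have hE1 : 0 ≤ E 1 := energy_nonneg hq hX one_pos le_rfl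
  have hch : Continuous h := continuous_iff_continuousAt.2 fun ρ => (H.hasDerivAt_snd ρ).continuousAt
  have hcJ : Continuous J := continuous_iff_continuousAt.2 fun ρ => (hJ ρ).continuousAt
  have b3 : ∫ ρ in (1 / 2 : ℝ)..1, h ρ ^ 2 ≤
      ∫ ρ in (1 / 2 : ℝ)..1, (2 * X ^ 2 * J ρ ^ 2 + 8 * E 1 / X ^ 2) := by
    refine intervalIntegral.integral_mono_on (by norm_num)
      (hch.pow 2).continuousOn.intervalIntegrable
      (Continuous.intervalIntegrable (by fun_prop) _ _) fun ρ hρ => ?_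
    have h0 : 0 < ρ := by linarith [hρ.1]
    have hA := coeff_ge hq hX h0 hρ.2
    have hR := H.abs_snd_div_sub_le hd hq0 hq hX hJ hJ0 h0 hρ.2
    rw [← hE] at hR
    set R := h ρ / (X - q * ρ ^ 2) - J ρ with hRdef
    have hA0 : X - q * ρ ^ 2 ≠ 0 := by linarith
    have hR2 : R ^ 2 ≤ 4 * E 1 / X ^ 4 := by
      rw [← sq_abs]
      calc |R| ^ 2 ≤ (2 * √(E 1) / X ^ 2) ^ 2 := by gcongr
        _ = _ := by rw [div_pow, mul_pow, Real.sq_sqrt hE1]; ring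
    have hh : h ρ = (X - q * ρ ^ 2) * (J ρ + R) := by rw [hRdef]; field_simp; ring
    have hAX : (X - q * ρ ^ 2) ^ 2 ≤ X ^ 2 := by
      refine pow_le_pow_left₀ (by linarith) ?_ 2
      nlinarith [sq_nonneg ρ]
    calc h ρ ^ 2 = (X - q * ρ ^ 2) ^ 2 * (J ρ + R) ^ 2 := by rw [hh]; ring
      _ ≤ X ^ 2 * (2 * J ρ ^ 2 + 2 * R ^ 2) := by
        gcongr; nlinarith [sq_nonneg (J ρ - R)]
      _ ≤ X ^ 2 * (2 * J ρ ^ 2 + 2 * (4 * E 1 / X ^ 4)) := by gcongr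
      _ = _ := by field_simp; ring
  have hi : ∫ ρ in (1 / 2 : ℝ)..1, (2 * X ^ 2 * J ρ ^ 2 + 8 * E 1 / X ^ 2) =
      2 * X ^ 2 * (∫ ρ in (1 / 2 : ℝ)..1, J ρ ^ 2) + 4 * E 1 / X ^ 2 := by
    rw [intervalIntegral.integral_add (Continuous.intervalIntegrable (by fun_prop) _ _)
      (by simp), intervalIntegral.integral_const_mul, intervalIntegral.integral_const, smul_eq_mul]
    ring
  have b4 : 4 * E 1 / X ^ 2 ≤ E 1 / (16 * 4 ^ d) := by
    rw [div_le_div_iff₀ (by positivity) (by positivity)]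
    nlinarith [mul_le_mul_of_nonneg_left (show 64 * 4 ^ d ≤ X ^ 2 by nlinarith) hE1]
  have b5 : E 1 / (16 * 4 ^ d) ≤ 2 * X ^ 2 * ∫ ρ in (1 / 2 : ℝ)..1, J ρ ^ 2 := by
    have : E 1 / (8 * 4 ^ d) = E 1 / (16 * 4 ^ d) + E 1 / (16 * 4 ^ d) := by field_simp; ring
    linarith
  have h16 : (16 : ℝ) ^ d = 4 ^ d * 4 ^ d := by rw [← mul_pow]; norm_num
  have b6 := mul_le_mul_of_nonneg_left b5 (show 0 ≤ √X ^ d / (2 * X) by positivity)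
  calc 1 / (1024 * Real.exp 2 * 16 ^ d * (2 * d) ^ d)
      = X / (32 * Real.exp 2 * 4 ^ d * (2 * d) ^ d) / (32 * 4 ^ d * X) := by
        rw [h16]; field_simp; norm_num
    _ ≤ √X ^ d * E 1 / (32 * 4 ^ d * X) := by gcongr
    _ = √X ^ d / (2 * X) * (E 1 / (16 * 4 ^ d)) := by field_simp; ring
    _ ≤ √X ^ d / (2 * X) * (2 * X ^ 2 * ∫ ρ in (1 / 2 : ℝ)..1, J ρ ^ 2) := b6
    _ = _ := by rw [pow_add, hκ2]; field_simp

end RadialSystem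

lemma normLaguerre_radialSystem (m k : ℕ) {l : ℝ} (hl : 0 < l) :
    RadialSystem (2 * m + 1) (l * nuv (m + 1) k / 2) (l ^ 2 / 4)
      (fun ρ => (normLaguerre m k).eval (ρ ^ 2 * l / 2) * Real.exp (-(ρ ^ 2 * l / 4)))
      (fun ρ => -(ρ ^ (2 * m + 2) * l * (((normLaguerre m k).derivative.eval (ρ ^ 2 * l / 2) -
        (normLaguerre m k).eval (ρ ^ 2 * l / 2) / 2) * Real.exp (-(ρ ^ 2 * l / 4))))) := by
  have hu : ∀ c ρ : ℝ, HasDerivAt (fun ρ : ℝ => ρ ^ 2 * l / c) (2 * ρ * l / c) ρ := fun c ρ => by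
    refine (((hasDerivAt_pow 2 ρ).mul_const l).div_const c).congr_deriv ?_
    norm_num
  have hp : ∀ (p : Polynomial ℝ) (ρ : ℝ), HasDerivAt (fun ρ : ℝ => p.eval (ρ ^ 2 * l / 2))
      (p.derivative.eval (ρ ^ 2 * l / 2) * (2 * ρ * l / 2)) ρ := fun p ρ =>
    HasDerivAt.comp (h₂ := fun x => p.eval x) ρ (p.hasDerivAt (ρ ^ 2 * l / 2)) (hu 2 ρ)
  have he : ∀ ρ : ℝ, HasDerivAt (fun ρ : ℝ => Real.exp (-(ρ ^ 2 * l / 4)))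
      (Real.exp (-(ρ ^ 2 * l / 4)) * -(2 * ρ * l / 4)) ρ := fun ρ => (hu 4 ρ).neg.exp
  refine ⟨fun ρ hρ => ?_, fun ρ => ?_, by simp, fun ρ hρ hX => ?_⟩
  · refine ((hp _ ρ).mul (he ρ)).congr_deriv ?_
    have : ρ ^ (2 * m + 1) ≠ 0 := by positivity
    rw [pow_succ ρ (2 * m + 1)]
    field_simp
    ring
  · refine (((hasDerivAt_pow (2 * m + 2) ρ).mul_const l).mul
      (((hp _ ρ).sub ((hp _ ρ).div_const 2)).mul (he ρ))).neg.congr_deriv ?_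
    have hode := normLaguerre_ode m k (ρ ^ 2 * l / 2)
    simp only [Pi.mul_apply, Pi.sub_apply, nuv]
    rw [show 2 * m + 2 - 1 = 2 * m + 1 by omega, pow_succ ρ (2 * m + 1)]
    push_cast
    linear_combination (-2 * l * ρ ^ (2 * m + 1) * Real.exp (-(ρ ^ 2 * l / 4))) * hode
  · simp only [nuv] at hX
    push_cast at hX
    have hρl : 0 ≤ ρ ^ 2 * l := by positivity
    have h1 : k * (ρ ^ 2 * l / 2) ≤ 1 / 16 := by
      have : 0 ≤ (m : ℝ) * (ρ ^ 2 * l) := by positivity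
      nlinarith
    have h2 : ρ ^ 2 * l / 4 ≤ 1 / 16 := by
      have : 0 ≤ (m : ℝ) * (ρ ^ 2 * l) := by positivity
      have : 0 ≤ (k : ℝ) * (ρ ^ 2 * l) := by positivity
      nlinarith
    have h3 := normLaguerre_eval_ge m k (show 0 ≤ ρ ^ 2 * l / 2 by positivity)
    have h4 : Real.exp (k * (ρ ^ 2 * l / 2)) ≤ 16 / 15 := by
      have h5 := Real.add_one_le_exp (-(1 / 16 : ℝ))
      rw [Real.exp_neg, le_inv_comm₀ (by norm_num) (Real.exp_pos _)] at h5
      exact (Real.exp_le_exp.2 h1).trans (h5.trans (by norm_num))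
    have h6 := Real.add_one_le_exp (-(ρ ^ 2 * l / 4))
    nlinarith

/-- The primitive `∫₀^ρ r^{2m+1} φ(lr²/2) dr` of the normalized Laguerre function `φ`. -/
def lagPrimitive (m k : ℕ) (l ρ : ℝ) : ℝ :=
  ∫ r in (0 : ℝ)..ρ, r ^ (2 * m + 1) *
    ((normLaguerre m k).eval (r ^ 2 * l / 2) * Real.exp (-(r ^ 2 * l / 4)))

lemma hasDerivAt_lagPrimitive (m k : ℕ) (l ρ : ℝ) :
    HasDerivAt (lagPrimitive m k l) (ρ ^ (2 * m + 1) *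
      ((normLaguerre m k).eval (ρ ^ 2 * l / 2) * Real.exp (-(ρ ^ 2 * l / 4)))) ρ := by
  have hc : Continuous fun r : ℝ => r ^ (2 * m + 1) *
      ((normLaguerre m k).eval (r ^ 2 * l / 2) * Real.exp (-(r ^ 2 * l / 4))) := by
    fun_prop
  exact intervalIntegral.integral_hasDerivAt_right (hc.intervalIntegrable _ _)
    (hc.stronglyMeasurableAtFilter _ _) hc.continuousAt

lemma rk_mul_lagFun (m k : ℕ) {N t : ℝ} (hN : 0 < N) (ht : 0 < t) :
    rk (m + 1) k * (lagFun (m + 1) k (N * t) * t ^ (((m + 1 : ℕ) - 1 : ℝ) / 2)) =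
      N ^ ((m : ℝ) / 2) / m.factorial *
        (t ^ m * ((normLaguerre m k).eval (N * t) * Real.exp (-(N * t / 2)))) := by
  have hr : rk (m + 1) k * rk (m + 1) k = k.factorial / (m + k).factorial := by
    rw [rk, Real.mul_self_sqrt (by positivity), show m + 1 + k - 1 = m + k by omega]
  have hm : ((m + 1 : ℕ) : ℝ) - 1 = m := by push_cast; ring
  have hp : (N * t) ^ ((m : ℝ) / 2) * t ^ ((m : ℝ) / 2) = N ^ ((m : ℝ) / 2) * t ^ m := by
    rw [Real.mul_rpow hN.le ht.le, mul_assoc, ← Real.rpow_add ht, add_halves, Real.rpow_natCast]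
  rw [lagFun, hm, genLaguerre_eq m k (mul_pos hN ht), neg_div]
  calc _ = (rk (m + 1) k * rk (m + 1) k) * ((m + k).factorial / (k.factorial * m.factorial) : ℝ) *
        ((N * t) ^ ((m : ℝ) / 2) * t ^ ((m : ℝ) / 2)) *
        ((normLaguerre m k).eval (N * t) * Real.exp (-(N * t / 2))) := by ring
    _ = _ := by rw [hr, hp]; field_simp

lemma chiHatB_eq (m k : ℕ) {l ρ : ℝ} (hl : 0 < l) (hρ : 0 < ρ) :
    ρ ^ (2 * (m + 1) + 2) * chiHatB (m + 1) k (ρ ^ 2 * l) =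
      2 ^ (((m : ℝ) + 2) / 2) / (2 ^ m * m.factorial) *
        (Real.sinc (ρ ^ 2 * l) * ρ ^ 2 * lagPrimitive m k l ρ) := by
  have hN : (0 : ℝ) < nuv (m + 1) k := by simp only [nuv]; push_cast; positivity
  rw [chiHatB]
  set N : ℝ := (nuv (m + 1) k : ℝ)
  have hI : rk (m + 1) k * ∫ t in (0 : ℝ)..(ρ ^ 2 * l / (2 * N)),
      lagFun (m + 1) k (N * t) * t ^ (((m + 1 : ℕ) - 1 : ℝ) / 2) =
      N ^ ((m : ℝ) / 2) / m.factorial * ((l / (2 * N)) ^ m * (l / N) * lagPrimitive m k l ρ) := by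
    have hsub := intervalIntegral.integral_comp_mul_deriv (a := 0) (b := ρ)
      (f := fun r : ℝ => r ^ 2 * l / (2 * N)) (f' := fun r => r * l / N)
      (g := fun t => t ^ m * ((normLaguerre m k).eval (N * t) * Real.exp (-(N * t / 2))))
      (fun r _ => by
        refine (((hasDerivAt_pow 2 r).mul_const l).div_const (2 * N)).congr_deriv ?_
        field_simp; norm_num) (by fun_prop) (by fun_prop)
    simp only [ne_eq, OfNat.ofNat_ne_zero, not_false_eq_true, zero_pow, zero_mul, zero_div] at hsub
    rw [← intervalIntegral.integral_const_mul]
    calc _ = ∫ t in (0 : ℝ)..(ρ ^ 2 * l / (2 * N)), N ^ ((m : ℝ) / 2) / m.factorial *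
          (t ^ m * ((normLaguerre m k).eval (N * t) * Real.exp (-(N * t / 2)))) := by
          refine intervalIntegral.integral_congr_ae (Filter.Eventually.of_forall fun t ht => ?_)
          rw [Set.uIoc_of_le (by positivity)] at ht
          exact rk_mul_lagFun m k hN ht.1
      _ = _ := by
          rw [intervalIntegral.integral_const_mul, ← hsub, lagPrimitive]
          congr 1
          rw [← intervalIntegral.integral_const_mul]
          congr 1
          ext r
          have e1 : N * (r ^ 2 * l / (2 * N)) = r ^ 2 * l / 2 := by field_simp
          simp only [Function.comp, e1]
          rw [show r ^ 2 * l / 2 / 2 = r ^ 2 * l / 4 by ring,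
            show r ^ 2 * l / (2 * N) = r ^ 2 * (l / (2 * N)) by ring, mul_pow, ← pow_mul,
            pow_succ r (2 * m)]
          ring
  have hpow : (2 * N) ^ ((((m + 1 : ℕ) : ℝ) + 1) / 2) * N ^ ((m : ℝ) / 2) =
      2 ^ (((m : ℝ) + 2) / 2) * N ^ (m + 1) := by
    rw [Real.mul_rpow (by norm_num) hN.le, mul_assoc, ← Real.rpow_add hN, ← Real.rpow_natCast]
    push_cast
    ring_nf
  have hμ : ρ ^ 2 * l ≠ 0 := by positivity
  rw [Real.sinc_of_ne_zero hμ]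
  calc _ = ρ ^ (2 * (m + 1) + 2) * (Real.sin (ρ ^ 2 * l) / (ρ ^ 2 * l) ^ (m + 1 + 1)) *
        (2 * N) ^ ((((m + 1 : ℕ) : ℝ) + 1) / 2) * (rk (m + 1) k *
        ∫ t in (0 : ℝ)..(ρ ^ 2 * l / (2 * N)),
          lagFun (m + 1) k (N * t) * t ^ (((m + 1 : ℕ) - 1 : ℝ) / 2)) := by ring
    _ = ρ ^ (2 * (m + 1) + 2) * (Real.sin (ρ ^ 2 * l) / (ρ ^ 2 * l) ^ (m + 1 + 1)) *
        ((2 * N) ^ ((((m + 1 : ℕ) : ℝ) + 1) / 2) * N ^ ((m : ℝ) / 2)) / m.factorial *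
        ((l / (2 * N)) ^ m * (l / N) * lagPrimitive m k l ρ) := by rw [hI]; ring
    _ = _ := by
      rw [hpow, mul_pow, div_pow, mul_pow, ← pow_mul]
      field_simp
      ring

lemma integral_sq_chiHatB_ge (m k : ℕ) {l : ℝ} (hl : 0 < l) (hl1 : l ≤ 1) :
    (2 ^ (((m : ℝ) + 2) / 2) / (2 ^ m * m.factorial)) ^ 2 / 4 *
        ∫ ρ in (0 : ℝ)..1, ρ ^ 4 * lagPrimitive m k l ρ ^ 2 ≤
      ∫ ρ in (0 : ℝ)..1, (ρ ^ (2 * (m + 1) + 2) * chiHatB (m + 1) k (ρ ^ 2 * l)) ^ 2 := by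
  set K : ℝ := 2 ^ (((m : ℝ) + 2) / 2) / (2 ^ m * m.factorial)
  have hcJ : Continuous (lagPrimitive m k l) :=
    continuous_iff_continuousAt.2 fun ρ => (hasDerivAt_lagPrimitive m k l ρ).continuousAt
  have heq : ∫ ρ in (0 : ℝ)..1, (ρ ^ (2 * (m + 1) + 2) * chiHatB (m + 1) k (ρ ^ 2 * l)) ^ 2 =
      ∫ ρ in (0 : ℝ)..1, (K * (Real.sinc (ρ ^ 2 * l) * ρ ^ 2 * lagPrimitive m k l ρ)) ^ 2 := by
    refine intervalIntegral.integral_congr_ae (Filter.Eventually.of_forall fun ρ hρ => ?_)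
    rw [Set.uIoc_of_le zero_le_one] at hρ
    rw [chiHatB_eq m k hl hρ.1]
  have hcs : Continuous Real.sinc := Real.continuous_sinc
  rw [heq, ← intervalIntegral.integral_const_mul]
  refine intervalIntegral.integral_mono_on zero_le_one
    (Continuous.intervalIntegrable (by fun_prop) _ _)
    (Continuous.intervalIntegrable (by fun_prop) _ _) fun ρ hρ => ?_
  have hs : 1 / 2 ≤ Real.sinc (ρ ^ 2 * l) := by
    have h0 : 0 ≤ ρ ^ 2 * l := by positivity
    have h1 : ρ ^ 2 * l ≤ 1 := mul_le_one₀ (pow_le_one₀ hρ.1 hρ.2) hl.le hl1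
    rcases h0.eq_or_lt with h | h
    · rw [← h, Real.sinc_zero]; norm_num
    · rw [Real.sinc_of_ne_zero h.ne', le_div_iff₀ h]
      refine le_trans ?_ (Real.mul_le_sin h0 (by linarith [Real.pi_gt_three]))
      refine mul_le_mul_of_nonneg_right ?_ h0
      rw [div_le_div_iff₀ (by norm_num) Real.pi_pos]
      linarith [Real.pi_le_four]
  calc K ^ 2 / 4 * (ρ ^ 4 * lagPrimitive m k l ρ ^ 2)
      = (1 / 2) ^ 2 * (K * (ρ ^ 2 * lagPrimitive m k l ρ)) ^ 2 := by ring
    _ ≤ Real.sinc (ρ ^ 2 * l) ^ 2 * (K * (ρ ^ 2 * lagPrimitive m k l ρ)) ^ 2 := by gcongr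
    _ = _ := by ring

lemma integral_sq_lagPrimitive_ge_of_large (m k : ℕ) {l : ℝ} (hl : 0 < l) (hl1 : l ≤ 1)
    (hX : 8 * 4 ^ (2 * m + 1) ≤ √(l * nuv (m + 1) k / 2)) :
    1 / (16384 * Real.exp 2 * 16 ^ (2 * m + 1) * (2 * (2 * m + 1 : ℕ)) ^ (2 * m + 1)) ≤
      √(l * nuv (m + 1) k / 2) ^ (2 * m + 3) *
        ∫ ρ in (0 : ℝ)..1, ρ ^ 4 * lagPrimitive m k l ρ ^ 2 := by
  have hcJ : Continuous (lagPrimitive m k l) :=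
    continuous_iff_continuousAt.2 fun ρ => (hasDerivAt_lagPrimitive m k l ρ).continuousAt
  have key := (normLaguerre_radialSystem m k hl).integral_sq_primitive_ge (by omega) (by positivity)
    (by nlinarith) hX (hasDerivAt_lagPrimitive m k l) (by simp [lagPrimitive])
  have h1 : 1 / 16 * ∫ ρ in (1 / 2 : ℝ)..1, lagPrimitive m k l ρ ^ 2 ≤
      ∫ ρ in (0 : ℝ)..1, ρ ^ 4 * lagPrimitive m k l ρ ^ 2 := by
    rw [← intervalIntegral.integral_const_mul]
    refine (intervalIntegral.integral_mono_on (by norm_num)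
      (Continuous.intervalIntegrable (by fun_prop) _ _)
      (Continuous.intervalIntegrable (by fun_prop) _ _)
      (g := fun ρ => ρ ^ 4 * lagPrimitive m k l ρ ^ 2) fun ρ hρ => ?_).trans
      (intervalIntegral.integral_mono_interval (by norm_num) (by norm_num) le_rfl
        (Filter.Eventually.of_forall fun ρ => ?_) (Continuous.intervalIntegrable (by fun_prop) _ _))
    · refine mul_le_mul_of_nonneg_right ?_ (sq_nonneg _)
      calc (1 / 16 : ℝ) = (1 / 2) ^ 4 := by norm_num
        _ ≤ ρ ^ 4 := pow_le_pow_left₀ (by norm_num) hρ.1 4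
    · simp only [Pi.zero_apply]; positivity
  have h2 := mul_le_mul_of_nonneg_left h1
    (show 0 ≤ √(l * nuv (m + 1) k / 2) ^ (2 * m + 3) by positivity)
  calc _ = 1 / 16 * (1 / (1024 * Real.exp 2 * 16 ^ (2 * m + 1) *
        (2 * (2 * m + 1 : ℕ)) ^ (2 * m + 1))) := by field_simp; norm_num
    _ ≤ 1 / 16 * (√(l * nuv (m + 1) k / 2) ^ (2 * m + 1 + 2) *
        ∫ ρ in (1 / 2 : ℝ)..1, lagPrimitive m k l ρ ^ 2) := by gcongr
    _ ≤ _ := by linarith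

lemma integral_sq_lagPrimitive_ge_of_small (m k : ℕ) {l b : ℝ} (hl : 0 < l) (hb : 0 < b)
    (hb1 : b ≤ 1) (hX : l * nuv (m + 1) k / 2 * b ^ 2 ≤ 1 / 4) :
    b ^ (4 * m + 9) / (4 * (2 * m + 2) ^ 2 * (4 * m + 9)) ≤
      ∫ ρ in (0 : ℝ)..1, ρ ^ 4 * lagPrimitive m k l ρ ^ 2 := by
  have hcJ : Continuous (lagPrimitive m k l) :=
    continuous_iff_continuousAt.2 fun ρ => (hasDerivAt_lagPrimitive m k l ρ).continuousAt
  have hJ : ∀ ρ ∈ Set.Icc 0 b, ρ ^ (2 * m + 2) / (2 * (2 * m + 2)) ≤ lagPrimitive m k l ρ := by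
    intro ρ hρ
    calc ρ ^ (2 * m + 2) / (2 * (2 * m + 2))
        = ∫ r in (0 : ℝ)..ρ, r ^ (2 * m + 1) * (1 / 2) := by
          rw [intervalIntegral.integral_mul_const, integral_pow]
          push_cast
          rw [zero_pow (by omega), sub_zero, show (2 * (m : ℝ) + 1 + 1) = 2 * m + 2 by ring]
          field_simp
      _ ≤ _ := by
          refine intervalIntegral.integral_mono_on hρ.1
            (Continuous.intervalIntegrable (by fun_prop) _ _)
            (Continuous.intervalIntegrable (by fun_prop) _ _) fun r hr => ?_
          refine mul_le_mul_of_nonneg_left ?_ (pow_nonneg hr.1 _)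
          refine (normLaguerre_radialSystem m k hl).half_le r hr.1 (le_trans ?_ hX)
          have := hr.1
          have := hr.2.trans hρ.2
          gcongr
  calc b ^ (4 * m + 9) / (4 * (2 * m + 2) ^ 2 * (4 * m + 9))
      = ∫ ρ in (0 : ℝ)..b, ρ ^ (4 * m + 8) * (1 / (4 * (2 * m + 2) ^ 2)) := by
        rw [intervalIntegral.integral_mul_const, integral_pow]
        push_cast
        rw [zero_pow (by omega), sub_zero, show (4 * (m : ℝ) + 8 + 1) = 4 * m + 9 by ring]
        field_simp
    _ ≤ ∫ ρ in (0 : ℝ)..b, ρ ^ 4 * lagPrimitive m k l ρ ^ 2 := by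
        refine intervalIntegral.integral_mono_on hb.le
          (Continuous.intervalIntegrable (by fun_prop) _ _)
          (Continuous.intervalIntegrable (by fun_prop) _ _) fun r hr => ?_
        have h0 := hr.1
        calc r ^ (4 * m + 8) * (1 / (4 * (2 * m + 2) ^ 2))
            = r ^ 4 * (r ^ (2 * m + 2) / (2 * (2 * m + 2))) ^ 2 := by
              rw [div_pow, ← pow_mul, show 4 * m + 8 = 4 + (2 * m + 2) * 2 by ring, pow_add]
              field_simp
              norm_num
          _ ≤ _ := by
              gcongr
              exact hJ r hr
    _ ≤ _ := intervalIntegral.integral_mono_interval le_rfl hb.le hb1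
        (Filter.Eventually.of_forall fun ρ => by simp only [Pi.zero_apply]; positivity)
        (Continuous.intervalIntegrable (by fun_prop) _ _)

lemma rpow_le_factorial_mul_exp {x p : ℝ} (hx : 0 ≤ x) (hp : 0 ≤ p) {N : ℕ} (hN : p ≤ N) :
    x ^ p ≤ N.factorial * Real.exp x := by
  have hf : (1 : ℝ) ≤ N.factorial := by exact_mod_cast N.factorial_pos
  rcases le_total x 1 with h | h
  · calc x ^ p ≤ 1 := Real.rpow_le_one hx h hp
      _ ≤ N.factorial * Real.exp x := one_le_mul_of_one_le_of_one_le hf (Real.one_le_exp hx)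
  · calc x ^ p ≤ x ^ (N : ℝ) := Real.rpow_le_rpow_of_exponent_le h hN
      _ = x ^ N := Real.rpow_natCast x N
      _ ≤ _ := by
        have := Real.pow_div_factorial_le_exp x hx N
        rwa [div_le_iff₀' (by positivity)] at this

/-- Estimate for the term `𝓘(Λ,s)`: there is `c > 0` so that for all
`0 < s < 1` and `Λ > 0` with `sΛ > Q−1` (`Q = 2n+2`), and all `(k,λ)` with `λ ≠ 0`,
`|λ| ≤ 1` and `⟨λν⟩ ≤ Λ` (`ν = 4k+2n`),
`e^{(1/2)ν|λ|s} ∫₀¹ |χ̂_{B_ρ}(λ,k)|² dρ ≥ c s^{(Q−1)/2}`.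
(As an even function of `λ`, `χ̂_B(λ,k)` is evaluated at `|λ|`, and
`χ̂_{B_ρ}(λ,k) = ρ^{2n+2} χ̂_B(ρ²λ,k)`.) -/
theorem exp_weighted_avgSq_lower_bound (n : ℕ) (hn : 1 ≤ n) :
    ∃ c > (0 : ℝ), ∀ s Λ : ℝ, 0 < s → s < 1 → 0 < Λ →
      (2 * (n : ℝ) + 2) - 1 < s * Λ →
      ∀ (k : ℕ) (lam : ℝ), lam ≠ 0 → |lam| ≤ 1 → jap (lam * (nuv n k : ℝ)) ≤ Λ →
        c * s ^ (((2 * (n : ℝ) + 2) - 1) / 2) ≤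
          Real.exp ((1 / 2) * (nuv n k : ℝ) * |lam| * s) *
            ∫ ρ in (0 : ℝ)..1, (ρ ^ (2 * n + 2) * chiHatB n k (ρ ^ 2 * |lam|)) ^ 2 := by
  obtain ⟨m, rfl⟩ : ∃ m, n = m + 1 := ⟨n - 1, by omega⟩
  set K : ℝ := (2 ^ (((m : ℝ) + 2) / 2) / (2 ^ m * m.factorial)) ^ 2 / 4 with hK
  have hK0 : 0 < K := by positivity
  set c₁ : ℝ :=
    1 / (16384 * Real.exp 2 * 16 ^ (2 * m + 1) * (2 * (2 * m + 1 : ℕ)) ^ (2 * m + 1)) with hc₁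
  have hc₁0 : 0 < c₁ := by positivity
  set b : ℝ := 1 / (16 * 4 ^ (2 * m + 1)) with hb
  have hb0 : 0 < b := by positivity
  have hb1 : b ≤ 1 := by
    rw [hb, div_le_one (by positivity)]
    linarith [one_le_pow₀ (n := 2 * m + 1) (show (1 : ℝ) ≤ 4 by norm_num)]
  set c₂ : ℝ := b ^ (4 * m + 9) / (4 * (2 * m + 2) ^ 2 * (4 * m + 9)) with hc₂
  have hc₂0 : 0 < c₂ := by positivity
  refine ⟨min (K * c₁ / (m + 2).factorial) (K * c₂), lt_min (by positivity) (by positivity), ?_⟩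
  intro s Λ hs0 hs1 _ _ k lam hlam hlam1 _
  have hl : 0 < |lam| := abs_pos.2 hlam
  set X : ℝ := |lam| * nuv (m + 1) k / 2 with hX
  have hX0 : 0 < X := by simp only [hX, nuv]; positivity
  set p : ℝ := ((2 * ((m + 1 : ℕ) : ℝ) + 2) - 1) / 2 with hp
  have hp0 : 0 ≤ p := by rw [hp]; push_cast; linarith [(Nat.cast_nonneg m : (0 : ℝ) ≤ m)]
  have hI := integral_sq_chiHatB_ge m k hl hlam1
  rw [← hK] at hI
  rw [show 1 / 2 * (nuv (m + 1) k : ℝ) * |lam| * s = X * s by rw [hX]; ring]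
  refine le_trans ?_ (mul_le_mul_of_nonneg_left hI (Real.exp_pos _).le)
  rcases le_or_gt (8 * 4 ^ (2 * m + 1)) √X with h | h
  · have h1 := integral_sq_lagPrimitive_ge_of_large m k hl hlam1 h
    rw [← hX, ← hc₁] at h1
    set I := ∫ ρ in (0 : ℝ)..1, ρ ^ 4 * lagPrimitive m k |lam| ρ ^ 2
    have hXp : X ^ p = √X ^ (2 * m + 3) := by
      rw [Real.sqrt_eq_rpow, ← Real.rpow_natCast, ← Real.rpow_mul hX0.le, hp]
      congr 1
      push_cast
      ring
    have h2 := rpow_le_factorial_mul_exp (mul_pos hX0 hs0).le hp0 (N := m + 2)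
      (by rw [hp]; push_cast; linarith [(Nat.cast_nonneg m : (0 : ℝ) ≤ m)])
    rw [Real.mul_rpow hX0.le hs0.le, hXp] at h2
    have hI0 : 0 ≤ I := by
      by_contra hneg
      push Not at hneg
      have : √X ^ (2 * m + 3) * I ≤ 0 := mul_nonpos_of_nonneg_of_nonpos (by positivity) hneg.le
      linarith
    calc min (K * c₁ / (m + 2).factorial) (K * c₂) * s ^ p
        ≤ K * c₁ / (m + 2).factorial * s ^ p := by
          gcongr
          exact min_le_left _ _
      _ ≤ K * (√X ^ (2 * m + 3) * I) / (m + 2).factorial * s ^ p := by gcongr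
      _ = K * I / (m + 2).factorial * (√X ^ (2 * m + 3) * s ^ p) := by ring
      _ ≤ K * I / (m + 2).factorial * ((m + 2).factorial * Real.exp (X * s)) := by gcongr
      _ = _ := by field_simp
  · have hXb : X * b ^ 2 ≤ 1 / 4 := by
      have h3 : √X * b ≤ 1 / 2 := by
        rw [hb, mul_one_div, div_le_iff₀ (by positivity)]
        linarith
      have h4 : X * b ^ 2 = (√X * b) ^ 2 := by rw [mul_pow, Real.sq_sqrt hX0.le]
      rw [h4]
      nlinarith [show 0 ≤ √X * b by positivity]
    have h1 := integral_sq_lagPrimitive_ge_of_small m k hl hb0 hb1 hXb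
    rw [← hc₂] at h1
    calc min (K * c₁ / (m + 2).factorial) (K * c₂) * s ^ p
        ≤ K * c₂ * 1 := by
          gcongr
          · exact min_le_right _ _
          · exact Real.rpow_le_one hs0.le hs1.le hp0
      _ = 1 * (K * c₂) := by ring
      _ ≤ _ := by
          gcongr
          exact Real.one_le_exp (by positivity)
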